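/- Every boundedly-finite shift-homogeneous metric space X is coarsely isomorphic to the product X_{s(X)} × ℤ_{φ_X}, where ℤ_{φ_X} is endowed with a proper left-invariant metric. -/

import Mathlib

open scoped ENNReal symmDiff

noncomputable section

/-- The supremum in `ℕ∞` of a set of natural numbers. -/
def natSup (s : Set ℕ) : ℕ∞ := sSup ((↑) '' s : Set ℕ∞)

/-- The `ε`-connected component of a point `x`: all points linkable to `x` by a chain with
consecutive distances `≤ ε` (for `ε = ∞` this is the whole space). -/
def comp (X : Type*) [MetricSpace X] (ε : ℝ≥0∞) (x : X) : Set X :=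
  {y | Relation.ReflTransGen (fun a b => edist a b ≤ ε) x y}

/-- `ss X` is the set of `ε ∈ [0,∞]` such that for every finite `δ ≥ ε` and every point `x` the
set `{X_ε(y) : y ∈ X_δ(x)}` of `ε`-components of points of `X_δ(x)` is finite. -/
def ssSet (X : Type*) [MetricSpace X] : Set ℝ≥0∞ :=
  {ε | ∀ δ : ℝ≥0∞, δ ≠ ⊤ → ε ≤ δ → ∀ x : X, ((comp X ε) '' (comp X δ x)).Finite}

/-- The factorizing step `s(X) = inf ss(X)`. -/
def sStep (X : Type*) [MetricSpace X] : ℝ≥0∞ := sInf (ssSet X)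

/-- A metric space is boundedly-finite if every bounded subset is finite. -/
def BoundedlyFinite (X : Type*) [MetricSpace X] : Prop :=
  ∀ s : Set X, Bornology.IsBounded s → s.Finite

/-- A metric space is homogeneous if for any two points there is a bijective self-isometry
moving one to the other. -/
def Homogeneous (X : Type*) [MetricSpace X] : Prop :=
  ∀ x y : X, ∃ f : X ≃ᵢ X, f x = y

/-- A subset `C` is large scale connected if any two of its points can be linked by an
`ε`-chain for a common finite `ε`. -/
def IsLSCSet {X : Type*} [MetricSpace X] (C : Set X) : Prop :=
  ∃ ε : ℝ≥0∞, ε ≠ ⊤ ∧ ∀ x ∈ C, ∀ y ∈ C, y ∈ comp X ε x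

/-- A metric space is large scale connected if it coincides with an `ε`-connected component
for some finite `ε`. -/
def LargeScaleConnected (X : Type*) [MetricSpace X] : Prop :=
  ∃ ε : ℝ≥0∞, ε ≠ ⊤ ∧ ∀ x y : X, y ∈ comp X ε x

/-- A metric space is shift-homogeneous if any point can be moved to any other point by a
bijective self-isometry whose displacement is bounded on each large scale connected subset. -/
def ShiftHomogeneous (X : Type*) [MetricSpace X] : Prop :=
  ∀ x y : X, ∃ f : X ≃ᵢ X, f x = y ∧
    ∀ C : Set X, IsLSCSet C → ∃ M : ℝ, ∀ c ∈ C, dist (f c) c ≤ M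

/-- The oscillation `ω_f(δ) = sup {d (f x) (f x') : d x x' ≤ δ}` of a map, in `[0,∞]`. -/
def osc {X Y : Type*} [MetricSpace X] [MetricSpace Y] (f : X → Y) (δ : ℝ≥0∞) : ℝ≥0∞ :=
  ⨆ (x : X) (x' : X) (_ : edist x x' ≤ δ), edist (f x) (f x')

/-- A map between metric spaces is coarse if its oscillation at each finite `δ` is finite. -/
def CoarseMapM {X Y : Type*} [MetricSpace X] [MetricSpace Y] (f : X → Y) : Prop :=
  ∀ δ : ℝ≥0∞, δ ≠ ⊤ → osc f δ ≠ ⊤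

/-- Two metric spaces are coarsely isomorphic if there is a bijection between them which is
coarse in both directions. -/
def CoarselyIsomorphic (X Y : Type*) [MetricSpace X] [MetricSpace Y] : Prop :=
  ∃ f : X ≃ Y, CoarseMapM ⇑f ∧ CoarseMapM ⇑f.symm

/-- Two metric spaces are coarsely equivalent if there are coarse maps in both directions whose
compositions are within finite distance of the identities. -/
def CoarselyEquivalent (X Y : Type*) [MetricSpace X] [MetricSpace Y] : Prop :=
  ∃ f : X → Y, CoarseMapM f ∧ ∃ g : Y → X, CoarseMapM g ∧
    (∃ M : ℝ, ∀ x : X, dist x (g (f x)) ≤ M) ∧ (∃ M : ℝ, ∀ y : Y, dist y (f (g y)) ≤ M)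

/-- A metric on a group is left-invariant if left translations are isometries. -/
def LeftInvariantMetric (G : Type*) [Group G] [MetricSpace G] : Prop :=
  ∀ g x y : G, dist (g * x) (g * y) = dist x y

/-- A metric on a countable space is proper if all closed balls are finite. -/
def ProperMetric (X : Type*) [MetricSpace X] : Prop :=
  ∀ (x : X) (r : ℝ), (Metric.closedBall x r).Finite

/-- The factorizing function `φ_X` of a boundedly-finite homogeneous metric space:
`φ_X(p) = sup {k ∈ ℕ : p^k divides |{X_{s(X)}(y) : y ∈ X_δ(x)}| for some finite δ and some x}`. -/
def phiSpace (X : Type*) [MetricSpace X] (p : Nat.Primes) : ℕ∞ :=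
  natSup {k : ℕ | ∃ δ : ℝ≥0∞, δ ≠ ⊤ ∧ ∃ x : X,
    ((comp X (sStep X)) '' (comp X δ x)).Finite ∧
    (p : ℕ) ^ k ∣ ((comp X (sStep X)) '' (comp X δ x)).ncard}

/-- `φ(p)` many copies: an index type of cardinality `k` (countably infinite when `k = ∞`). -/
def Copies (k : ℕ∞) : Type := if k = ⊤ then ℕ else Fin k.toNat

/-- The group `ℤ_φ = ⊕_{p prime} (ℤ/pℤ)^{(φ(p))}`: the direct sum, over all primes `p`, of
`φ(p)` copies of the cyclic group `ℤ/pℤ` (countably many copies when `φ(p) = ∞`). -/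
def Zphi (φ : Nat.Primes → ℕ∞) : Type :=
  Π₀ x : Σ p : Nat.Primes, Copies (φ p), ZMod (x.1 : ℕ)

noncomputable instance (φ : Nat.Primes → ℕ∞) : AddCommGroup (Zphi φ) :=
  inferInstanceAs (AddCommGroup (Π₀ x : Σ p : Nat.Primes, Copies (φ p), ZMod (x.1 : ℕ)))

section Components

variable {X : Type*} [MetricSpace X]

theorem mem_comp_self (ε : ℝ≥0∞) (x : X) : x ∈ comp X ε x := Relation.ReflTransGen.refl

theorem mem_comp_comm {ε : ℝ≥0∞} {x y : X} : y ∈ comp X ε x ↔ x ∈ comp X ε y := by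
  have key : ∀ x y : X, y ∈ comp X ε x → x ∈ comp X ε y := fun x y h => by
    have : Std.Symm (fun a b : X => edist a b ≤ ε) := ⟨fun a b hab => by rwa [edist_comm]⟩
    exact Relation.ReflTransGen.stdSymm.symm _ _ h
  exact ⟨key x y, key y x⟩

theorem mem_comp_trans {ε : ℝ≥0∞} {x y z : X} (hxy : y ∈ comp X ε x) (hyz : z ∈ comp X ε y) :
    z ∈ comp X ε x :=
  Relation.ReflTransGen.trans hxy hyz

theorem mem_comp_of_edist_le {ε : ℝ≥0∞} {x y : X} (h : edist x y ≤ ε) : y ∈ comp X ε x :=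
  Relation.ReflTransGen.single h

theorem comp_mono {ε δ : ℝ≥0∞} (h : ε ≤ δ) (x : X) : comp X ε x ⊆ comp X δ x :=
  fun _ hy => Relation.ReflTransGen.mono (fun _ _ hab => le_trans hab h) _ _ hy

theorem comp_eq_comp_iff {ε : ℝ≥0∞} {x y : X} :
    comp X ε x = comp X ε y ↔ y ∈ comp X ε x := by
  refine ⟨fun h => h ▸ mem_comp_self ε y, fun h => Set.Subset.antisymm ?_ ?_⟩
  · exact fun z hz => mem_comp_trans (mem_comp_comm.1 h) hz
  · exact fun z hz => mem_comp_trans h hz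

theorem map_mem_comp_iff (f : X ≃ᵢ X) {ε : ℝ≥0∞} {x y : X} :
    f y ∈ comp X ε (f x) ↔ y ∈ comp X ε x := by
  have key : ∀ (g : X ≃ᵢ X) (x y : X), y ∈ comp X ε x → g y ∈ comp X ε (g x) :=
    fun g x y h => Relation.ReflTransGen.lift g
      (fun a b (hab : edist a b ≤ ε) => (g.edist_eq a b).trans_le hab) _ _ h
  refine ⟨fun h => ?_, key f x y⟩
  simpa using key f.symm _ _ h

theorem comp_isometryEquiv_apply (f : X ≃ᵢ X) (ε : ℝ≥0∞) (x : X) :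
    comp X ε (f x) = f '' comp X ε x := by
  ext y
  constructor
  · intro hy
    refine ⟨f.symm y, ?_, by simp⟩
    rw [← map_mem_comp_iff f]
    simpa using hy
  · rintro ⟨z, hz, rfl⟩
    exact (map_mem_comp_iff f).2 hz

theorem comp_image_comp_map (f : X ≃ᵢ X) (ε δ : ℝ≥0∞) (x : X) :
    comp X ε '' comp X δ (f x) = Set.image f '' (comp X ε '' comp X δ x) := by
  rw [comp_isometryEquiv_apply, Set.image_image, Set.image_image]
  simp only [comp_isometryEquiv_apply]

theorem ncard_comp_image_comp (hX : Homogeneous X) (ε δ : ℝ≥0∞) (x y : X) :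
    (comp X ε '' comp X δ x).ncard = (comp X ε '' comp X δ y).ncard := by
  obtain ⟨f, rfl⟩ := hX x y
  rw [comp_image_comp_map, Set.ncard_image_of_injective _ f.injective.image_injective]

theorem comp_image_comp_of_le {ε δ : ℝ≥0∞} (h : δ ≤ ε) (x : X) :
    comp X ε '' comp X δ x = {comp X ε x} := by
  refine Set.Subset.antisymm ?_ ?_
  · rintro _ ⟨y, hy, rfl⟩
    exact (comp_eq_comp_iff.2 (comp_mono h x hy)).symm
  · rintro _ rfl
    exact ⟨x, mem_comp_self δ x, rfl⟩

theorem biUnion_comp {ε δ : ℝ≥0∞} (hεδ : ε ≤ δ) (y : X) :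
    ⋃ z ∈ comp X ε y, comp X δ z = comp X δ y := by
  refine Set.Subset.antisymm ?_ ?_
  · refine Set.iUnion₂_subset fun z hz => ?_
    rw [comp_eq_comp_iff.2 (comp_mono hεδ y hz)]
  · exact Set.subset_biUnion_of_mem (u := fun z => comp X δ z) (mem_comp_self ε y)

theorem finite_comp_image_comp_of_le {ε δ δ' : ℝ≥0∞} (hεδ : ε ≤ δ) {x : X}
    (h : (comp X ε '' comp X δ' x).Finite) : (comp X δ '' comp X δ' x).Finite := by
  have : comp X δ '' comp X δ' x
      = (fun S : Set X => ⋃ z ∈ S, comp X δ z) '' (comp X ε '' comp X δ' x) := by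
    rw [Set.image_image]
    exact Set.image_congr fun y _ => (biUnion_comp hεδ y).symm
  rw [this]
  exact h.image _

theorem ncard_comp_image_comp_mul (hX : Homogeneous X) {ε δ δ' : ℝ≥0∞} (hεδ : ε ≤ δ)
    (hδ : δ ≤ δ') (x : X) (hfin : (comp X ε '' comp X δ' x).Finite) :
    (comp X δ '' comp X δ' x).ncard * (comp X ε '' comp X δ x).ncard
      = (comp X ε '' comp X δ' x).ncard := by
  classical
  set π : Set X → Set X := fun S => ⋃ z ∈ S, comp X δ z
  have hπc : ∀ y, π (comp X ε y) = comp X δ y := biUnion_comp hεδ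
  have hfin' := finite_comp_image_comp_of_le hεδ hfin
  rw [Set.ncard_eq_toFinset_card _ hfin, Set.ncard_eq_toFinset_card _ hfin',
    Finset.card_eq_sum_card_fiberwise (s := hfin.toFinset) (f := π) (t := hfin'.toFinset)]
  · refine (Finset.sum_const_nat fun S hS => ?_).symm
    obtain ⟨y, hy, rfl⟩ := hfin'.mem_toFinset.1 hS
    rw [ncard_comp_image_comp hX ε δ x y, ← Set.ncard_coe_finset]
    congr 1
    ext T
    simp only [Finset.coe_filter, Set.Finite.mem_toFinset, Set.mem_ofPred_eq]
    constructor
    · rintro ⟨⟨z, hz, rfl⟩, h⟩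
      rw [hπc, comp_eq_comp_iff] at h
      exact ⟨z, mem_comp_comm.1 h, rfl⟩
    · rintro ⟨z, hz, rfl⟩
      refine ⟨⟨z, mem_comp_trans hy (comp_mono hδ y hz), rfl⟩, ?_⟩
      rw [hπc, comp_eq_comp_iff]
      exact mem_comp_comm.1 hz
  · intro S hS
    rw [Finset.mem_coe, hfin.mem_toFinset] at hS
    obtain ⟨y, hy, rfl⟩ := hS
    rw [hπc]
    exact hfin'.mem_toFinset.2 ⟨y, hy, rfl⟩

theorem ShiftHomogeneous.homogeneous (hX : ShiftHomogeneous X) : Homogeneous X :=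
  fun x y => (hX x y).imp fun _ h => h.1

/-- The factorizing step belongs to `ss X` when it is finite: distances from a point form a
locally finite set, so `ε`-components do not change for `ε` slightly above `s(X)`. -/
theorem finite_comp_sStep_image_comp (hXb : BoundedlyFinite X) (hX : Homogeneous X)
    (hs : sStep X ≠ ⊤) {δ : ℝ≥0∞} (hδ : δ ≠ ⊤) (x : X) :
    (comp X (sStep X) '' comp X δ x).Finite := by
  set s := sStep X with hsdef
  have hball : {y : X | edist x y ≤ s + 1}.Finite := by
    have h1 : s + 1 ≠ ⊤ := by simp [hs]
    refine (hXb (Metric.closedBall x (s + 1).toReal) Metric.isBounded_closedBall).subset ?_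
    intro y hy
    rw [Metric.mem_closedBall, dist_comm, dist_edist]
    exact ENNReal.toReal_mono h1 hy
  have hV : ((edist x '' {y : X | edist x y ≤ s + 1}) ∩ Set.Ioi s).Finite :=
    (hball.image _).inter_of_left _
  have hev : ∀ᶠ ε in nhdsWithin s (Set.Ioi s),
      ∀ v ∈ (edist x '' {y : X | edist x y ≤ s + 1}) ∩ Set.Ioi s, ε < v := by
    rw [Filter.eventually_all_finite hV]
    intro v hv
    exact mem_nhdsWithin_of_mem_nhds (Iio_mem_nhds hv.2)
  have hev1 : ∀ᶠ ε in nhdsWithin s (Set.Ioi s), ε < s + 1 :=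
    mem_nhdsWithin_of_mem_nhds (Iio_mem_nhds (ENNReal.lt_add_right hs one_ne_zero))
  have : (nhdsWithin s (Set.Ioi s)).NeBot :=
    nhdsGT_neBot_of_exists_gt ⟨⊤, lt_top_iff_ne_top.2 hs⟩
  obtain ⟨ε₀, ⟨h1, h2⟩, h3⟩ := ((hev.and hev1).and self_mem_nhdsWithin).exists
  obtain ⟨ε, hε, hεlt⟩ := sInf_lt_iff.1 (show sInf (ssSet X) < ε₀ from h3)
  have hsε : s ≤ ε := sInf_le hε
  have hgap : ∀ a b : X, edist a b ≤ ε → edist a b ≤ s := by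
    intro a b hab
    obtain ⟨f, hf⟩ := hX a x
    rw [← f.edist_eq, hf] at hab ⊢
    by_contra hlt
    have hle : edist x (f b) ≤ s + 1 := hab.trans (hεlt.le.trans h2.le)
    exact absurd (h1 _ ⟨⟨f b, hle, rfl⟩, not_le.1 hlt⟩) (not_lt.2 (hab.trans hεlt.le))
  have hcomp : comp X s = comp X ε := by
    funext y
    exact Set.Subset.antisymm (comp_mono hsε y)
      fun z hz => Relation.ReflTransGen.mono (fun a b hab => hgap a b hab) _ _ hz
  rw [hcomp]
  refine (hε (max δ ε) ?_ (le_max_right _ _) x).subset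
    (Set.image_mono (comp_mono (le_max_left _ _) x))
  exact (max_lt (lt_top_iff_ne_top.2 hδ) (hεlt.trans_le le_top)).ne

end Components

section Shifts

variable {X : Type*} [MetricSpace X]

/-- An isometry whose displacement is bounded on each large scale connected subset. -/
def IsShift (f : X ≃ᵢ X) : Prop :=
  ∀ C : Set X, IsLSCSet C → ∃ M : ℝ, ∀ c ∈ C, dist (f c) c ≤ M

theorem isShift_refl : IsShift (IsometryEquiv.refl X) :=
  fun _ _ => ⟨0, fun c _ => (dist_self c).le⟩

theorem IsShift.trans {f g : X ≃ᵢ X} (hf : IsShift f) (hg : IsShift g) : IsShift (f.trans g) := by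
  rintro C ⟨ε, hε, hC⟩
  obtain ⟨M, hM⟩ := hf C ⟨ε, hε, hC⟩
  have himg : IsLSCSet (f '' C) := by
    refine ⟨ε, hε, ?_⟩
    rintro _ ⟨x, hx, rfl⟩ _ ⟨y, hy, rfl⟩
    exact (map_mem_comp_iff f).2 (hC x hx y hy)
  obtain ⟨M', hM'⟩ := hg _ himg
  refine ⟨M' + M, fun c hc => (dist_triangle _ (f c) _).trans (add_le_add ?_ (hM c hc))⟩
  exact hM' _ ⟨c, hc, rfl⟩

end Shifts

theorem exists_bijOn_of_ncard_eq {α β : Type*} {A : Set α} {B : Set β} (hA : A.Finite)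
    (hB : B.Finite) (h : A.ncard = B.ncard) {a : α} {b : β} (ha : a ∈ A) (hb : b ∈ B) :
    ∃ e : α → β, Set.BijOn e A B ∧ e a = b := by
  classical
  have : Nonempty β := ⟨b⟩
  obtain ⟨e, he⟩ := hA.exists_bijOn_of_encard_eq (t := B) (by
    rw [← hA.cast_ncard_eq, ← hB.cast_ncard_eq, h])
  refine ⟨Equiv.swap (e a) b ∘ e, (Equiv.swap_bijOn_self ?_).comp he, by simp⟩
  exact iff_of_true (he.mapsTo ha) hb

theorem ncard_image_quotient_mk_mul {Z : Type*} [AddCommGroup Z] {H K : AddSubgroup Z}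
    (hHK : H ≤ K) :
    ((QuotientAddGroup.mk' H) '' (K : Set Z)).ncard * Nat.card H = Nat.card K := by
  have h1 := AddSubgroup.relIndex_ker K (QuotientAddGroup.mk' H)
  rw [QuotientAddGroup.ker_mk'] at h1
  have h2 := AddSubgroup.relIndex_mul_relIndex ⊥ H K bot_le hHK
  rw [AddSubgroup.relIndex_bot_left, AddSubgroup.relIndex_bot_left, h1, mul_comm] at h2
  rw [← h2]
  rfl

/-- Given subgroups `H ≤ K` whose index is the number of `t`-components in `X_{t'}(x₀)`, one can
choose for each coset of `H` in `K` a shift moving `X_t(x₀)` to the corresponding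
`t`-component, together with a translate `ρ g ∈ H` of each `g` by a coset representative. -/
theorem exists_shifts_of_cosets {X : Type*} [MetricSpace X] (hX : ShiftHomogeneous X) (x₀ : X)
    {Z : Type*} [AddCommGroup Z] {H K : AddSubgroup Z} (hHK : H ≤ K) (hK : Finite K)
    {t t' : ℝ≥0∞} (hfin : (comp X t '' comp X t' x₀).Finite)
    (hcard : (comp X t '' comp X t' x₀).ncard * Nat.card H = Nat.card K) :
    ∃ (F : Z → X ≃ᵢ X) (ρ : Z → Z), (∀ g, IsShift (F g)) ∧
      (∀ g ∈ H, F g = IsometryEquiv.refl X ∧ ρ g = g) ∧ (∀ g, ρ g ∈ H) ∧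
      (∀ g g', g - g' ∈ H → F g = F g' ∧ ρ g - ρ g' = g - g') ∧
      (∀ g ∈ K, F g x₀ ∈ comp X t' x₀) ∧
      (∀ y ∈ comp X t' x₀, ∃ g ∈ K, y ∈ comp X t (F g x₀)) ∧
      (∀ g ∈ K, ∀ g' ∈ K, F g' x₀ ∈ comp X t (F g x₀) → g - g' ∈ H) := by
  set A : Set (Z ⧸ H) := (QuotientAddGroup.mk' H) '' (K : Set Z) with hA
  have hAfin : A.Finite := Set.Finite.image _ (Set.toFinite _)
  have hHfin : Finite H := Finite.of_injective _ (AddSubgroup.inclusion_injective hHK)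
  obtain ⟨e, he, he0⟩ := exists_bijOn_of_ncard_eq hAfin hfin
    (Nat.eq_of_mul_eq_mul_right (Nat.card_pos (α := H))
      ((ncard_image_quotient_mk_mul hHK).trans hcard.symm))
    (a := 0) (b := comp X t x₀) ⟨0, K.zero_mem, by simp⟩ ⟨x₀, mem_comp_self _ _, rfl⟩
  have hF : ∀ q : Z ⧸ H, ∃ f : X ≃ᵢ X, IsShift f ∧ (q = 0 → f = IsometryEquiv.refl X) ∧
      (q ∈ A → f x₀ ∈ comp X t' x₀ ∧ comp X t (f x₀) = e q) := by
    intro q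
    by_cases hq : q = 0
    · subst hq
      exact ⟨_, isShift_refl, fun _ => rfl, fun _ => ⟨mem_comp_self _ _, he0.symm⟩⟩
    · by_cases hqA : q ∈ A
      · obtain ⟨y, hy, hye⟩ := he.mapsTo hqA
        obtain ⟨f, hf, hfs⟩ := hX x₀ y
        exact ⟨f, hfs, fun h => absurd h hq, fun _ => by rw [hf]; exact ⟨hy, hye⟩⟩
      · exact ⟨_, isShift_refl, fun _ => rfl, fun h => absurd h hqA⟩
  have hr : ∀ q : Z ⧸ H, ∃ z : Z, (z : Z ⧸ H) = q ∧ (q = 0 → z = 0) := by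
    intro q
    by_cases hq : q = 0
    · exact ⟨0, by simp [hq], fun _ => rfl⟩
    · obtain ⟨z, hz⟩ := QuotientAddGroup.mk_surjective q
      exact ⟨z, hz, fun h => absurd h hq⟩
  choose f hfs hf0 hfA using hF
  choose r hrq hr0 using hr
  have hmk : ∀ g g' : Z, g - g' ∈ H → (g : Z ⧸ H) = g' := fun g g' h =>
    (QuotientAddGroup.eq_iff_sub_mem).2 h
  have hAmem : ∀ g ∈ K, (g : Z ⧸ H) ∈ A := fun g hg => ⟨g, hg, rfl⟩
  refine ⟨fun g => f g, fun g => g - r g, fun g => hfs _, ?_, ?_, ?_, ?_, ?_, ?_⟩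
  · intro g hg
    have : (g : Z ⧸ H) = 0 := (QuotientAddGroup.eq_zero_iff g).2 hg
    exact ⟨hf0 _ this, by simp only [hr0 _ this, sub_zero]⟩
  · exact fun g => QuotientAddGroup.eq_iff_sub_mem.1 (hrq g).symm
  · intro g g' h
    simp only [hmk g g' h]
    exact ⟨trivial, by abel⟩
  · exact fun g hg => (hfA _ (hAmem g hg)).1
  · intro y hy
    obtain ⟨q, ⟨g, hg, rfl⟩, hq⟩ := he.surjOn ⟨y, hy, rfl⟩
    refine ⟨g, hg, ?_⟩
    rw [← comp_eq_comp_iff]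
    exact (hfA _ (hAmem g hg)).2.trans hq
  · intro g hg g' hg' h
    have h' := comp_eq_comp_iff.2 h
    rw [(hfA _ (hAmem g hg)).2, (hfA _ (hAmem g' hg')).2] at h'
    exact QuotientAddGroup.eq_iff_sub_mem.1 (he.injOn (hAmem g hg) (hAmem g' hg') h')

/-- Along a tower of finite subgroups whose successive indices count the components of the
successive levels `t n`, the choices of `exists_shifts_of_cosets` assemble to a family of
isometries whose mutual displacement on `X_{t 0}(x₀)` is uniformly bounded on each coset. -/
theorem exists_isometries_of_tower {X : Type*} [MetricSpace X] (hX : ShiftHomogeneous X) (x₀ : X)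
    {Z : Type*} [AddCommGroup Z] {G : ℕ → AddSubgroup Z} (hG : Monotone G)
    (hGfin : ∀ n, Finite (G n)) (hGex : ∀ z, ∃ n, z ∈ G n)
    {t : ℕ → ℝ≥0∞} (ht : Monotone t) (ht' : t 0 ≠ ⊤)
    (hfin : ∀ n, (comp X (t n) '' comp X (t (n + 1)) x₀).Finite)
    (hcard : ∀ n, (comp X (t n) '' comp X (t (n + 1)) x₀).ncard * Nat.card (G n)
      = Nat.card (G (n + 1))) :
    ∃ E : Z → X ≃ᵢ X,
      (∀ k g g', g - g' ∈ G k ↔ E g' x₀ ∈ comp X (t k) (E g x₀)) ∧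
      (∀ n, ∀ y ∈ comp X (t n) x₀, ∃ g, y ∈ comp X (t 0) (E g x₀)) ∧
      (∀ k, ∃ M, ∀ g g', g - g' ∈ G k → ∀ c ∈ comp X (t 0) x₀, dist (E g c) (E g' c) ≤ M) := by
  choose F ρ hshift hid hρ hcos hmem hsurj hinj using fun n =>
    exists_shifts_of_cosets hX x₀ (hG n.le_succ) (hGfin (n + 1)) (hfin n) (hcard n)
  let e : ℕ → Z → X ≃ᵢ X := fun n => Nat.rec (fun _ => IsometryEquiv.refl X)
    (fun n en g => (en (ρ n g)).trans (F n g)) n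
  have hsucc : ∀ n g, e (n + 1) g = (e n (ρ n g)).trans (F n g) := fun n g => rfl
  have hstable : ∀ m n, n ≤ m → ∀ g ∈ G n, e m g = e n g := by
    intro m n hnm g hg
    induction m, hnm using Nat.le_induction with
    | base => rfl
    | succ m hnm ih =>
      obtain ⟨h1, h2⟩ := hid m g (hG hnm hg)
      rw [hsucc, h1, h2, ih]
      rfl
  have hesh : ∀ n g, IsShift (e n g) := by
    intro n
    induction n with
    | zero => exact fun _ => isShift_refl
    | succ n ih => exact fun g => (ih _).trans (hshift n g)
  have hemem : ∀ n, ∀ g ∈ G n, e n g x₀ ∈ comp X (t n) x₀ := by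
    intro n
    induction n with
    | zero => exact fun _ _ => mem_comp_self _ _
    | succ n ih =>
      exact fun g hg => mem_comp_trans (hmem n g hg)
        ((map_mem_comp_iff (F n g)).2 (comp_mono (ht n.le_succ) _ (ih _ (hρ n g))))
  have hesame : ∀ n, ∀ g ∈ G n, ∀ g' ∈ G n, ∀ k ≤ n,
      (g - g' ∈ G k ↔ e n g' x₀ ∈ comp X (t k) (e n g x₀)) := by
    intro n
    induction n with
    | zero =>
      intro g hg g' hg' k hk
      obtain rfl : k = 0 := by omega
      exact iff_of_true (sub_mem hg hg') (mem_comp_self _ _)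
    | succ n ih =>
      intro g hg g' hg' k hk
      rcases Nat.lt_or_eq_of_le hk with hk | rfl
      · have hkn : k ≤ n := by omega
        have hred : g - g' ∈ G n →
            (g - g' ∈ G k ↔ e (n + 1) g' x₀ ∈ comp X (t k) (e (n + 1) g x₀)) := by
          intro h
          obtain ⟨h1, h2⟩ := hcos n g g' h
          rw [← h2, ih _ (hρ n g) _ (hρ n g') k hkn, hsucc, hsucc, h1]
          exact (map_mem_comp_iff (F n g')).symm
        refine ⟨fun h => (hred (hG hkn h)).1 h, fun h => (hred ?_).2 h⟩
        have key : ∀ g, e (n + 1) g x₀ ∈ comp X (t n) (F n g x₀) := fun g =>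
          (map_mem_comp_iff (F n g)).2 (hemem n _ (hρ n g))
        exact hinj n g hg g' hg' (mem_comp_trans (mem_comp_trans (key g)
          (comp_mono (ht hkn) _ h)) (mem_comp_comm.1 (key g')))
      · exact iff_of_true (sub_mem hg hg')
          (mem_comp_trans (mem_comp_comm.1 (hemem _ g hg)) (hemem _ g' hg'))
  have hesurj : ∀ n, ∀ y ∈ comp X (t n) x₀, ∃ g ∈ G n, y ∈ comp X (t 0) (e n g x₀) := by
    intro n
    induction n with
    | zero => exact fun y hy => ⟨0, zero_mem _, hy⟩
    | succ n ih =>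
      intro y hy
      obtain ⟨g', hg', hy'⟩ := hsurj n y hy
      obtain ⟨h, hh, hyh⟩ := ih ((F n g').symm y) (by
        rw [← map_mem_comp_iff (F n g')]
        simpa using hy')
      have hdiff : (g' - ρ n g' + h) - g' ∈ G n := by
        have : (g' - ρ n g' + h) - g' = h - ρ n g' := by abel
        exact this ▸ sub_mem hh (hρ n g')
      obtain ⟨h1, h2⟩ := hcos n _ _ hdiff
      have h3 : ρ n (g' - ρ n g' + h) = h := by
        rw [sub_eq_iff_eq_add] at h2
        rw [h2]
        abel
      refine ⟨g' - ρ n g' + h, ?_, ?_⟩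
      · have := add_mem (hG n.le_succ hdiff) hg'
        rwa [sub_add_cancel] at this
      · rw [hsucc, h1, h3, ← map_mem_comp_iff (F n g').symm]
        simpa using hyh
  have hebdd : ∀ k, ∃ M, ∀ g ∈ G k, ∀ g' ∈ G k, ∀ c ∈ comp X (t 0) x₀,
      dist (e k g c) (e k g' c) ≤ M := by
    intro k
    have hC : IsLSCSet (comp X (t 0) x₀) :=
      ⟨t 0, ht', fun x hx y hy => mem_comp_trans (mem_comp_comm.1 hx) hy⟩
    choose B hB using fun g => hesh k g _ hC
    obtain ⟨b, hb⟩ := (Set.toFinite (B '' (G k : Set Z))).bddAbove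
    refine ⟨b + b, fun g hg g' hg' c hc => (dist_triangle_right _ _ c).trans ?_⟩
    have hb' : ∀ g ∈ G k, dist (e k g c) c ≤ b := fun g hg =>
      (hB g c hc).trans (hb ⟨g, hg, rfl⟩)
    linarith [hb' g hg, dist_comm c (e k g' c), hb' g' hg']
  have hebdd' : ∀ k, ∃ M, ∀ n, k ≤ n → ∀ g ∈ G n, ∀ g' ∈ G n, g - g' ∈ G k →
      ∀ c ∈ comp X (t 0) x₀, dist (e n g c) (e n g' c) ≤ M := by
    intro k
    obtain ⟨M, hM⟩ := hebdd k
    refine ⟨M, fun n hkn => ?_⟩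
    induction n, hkn using Nat.le_induction with
    | base => exact fun g hg g' hg' _ => hM g hg g' hg'
    | succ n hkn ih =>
      intro g hg g' hg' h c hc
      obtain ⟨h1, h2⟩ := hcos n g g' (hG hkn h)
      rw [hsucc, hsucc, h1]
      refine ((F n g').dist_eq _ _).trans_le ?_
      exact ih _ (hρ n g) _ (hρ n g') (h2 ▸ h) c hc
  choose N hN using hGex
  have hE : ∀ n, ∀ g ∈ G n, e (N g) g = e n g := fun n g hg =>
    (hstable (max n (N g)) (N g) (le_max_right _ _) g (hN g)).symm.trans
      (hstable (max n (N g)) n (le_max_left _ _) g hg)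
  have hcommon : ∀ k g g', ∃ n, k ≤ n ∧ g ∈ G n ∧ g' ∈ G n := fun k g g' =>
    ⟨max k (max (N g) (N g')), le_max_left _ _,
      hG ((le_max_left _ _).trans (le_max_right _ _)) (hN g),
      hG ((le_max_right _ _).trans (le_max_right _ _)) (hN g')⟩
  refine ⟨fun g => e (N g) g, ?_, ?_, ?_⟩
  · intro k g g'
    obtain ⟨n, hkn, hg, hg'⟩ := hcommon k g g'
    simp only [hE n g hg, hE n g' hg']
    exact hesame n g hg g' hg' k hkn
  · intro n y hy
    obtain ⟨g, hg, h⟩ := hesurj n y hy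
    exact ⟨g, by simpa only [hE n g hg] using h⟩
  · intro k
    obtain ⟨M, hM⟩ := hebdd' k
    refine ⟨M, fun g g' h => ?_⟩
    obtain ⟨n, hkn, hg, hg'⟩ := hcommon k g g'
    simp only [hE n g hg, hE n g' hg']
    exact hM n hkn g hg g' hg' h

theorem coarseMapM_of_dist_le {X Y : Type*} [MetricSpace X] [MetricSpace Y] {f : X → Y}
    (h : ∀ r : ℝ, ∃ M : ℝ, ∀ x x', dist x x' ≤ r → dist (f x) (f x') ≤ M) : CoarseMapM f := by
  intro δ hδ
  obtain ⟨M, hM⟩ := h δ.toReal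
  refine ne_top_of_le_ne_top (ENNReal.ofReal_ne_top (r := M)) ?_
  refine iSup_le fun x => iSup_le fun x' => iSup_le fun hx => ?_
  rw [edist_dist]
  refine ENNReal.ofReal_le_ofReal (hM x x' ?_)
  rw [dist_edist]
  exact ENNReal.toReal_mono hδ hx

theorem coarselyIsomorphic_prod_of_isometries {X : Type*} [MetricSpace X] {ε : ℝ≥0∞} {x₀ : X}
    {Z : Type*} [AddCommGroup Z] [MetricSpace Z]
    (hinv : ∀ a x y : Z, dist (a + x) (a + y) = dist x y) (hproper : ProperMetric Z)
    {G : ℕ → AddSubgroup Z} (hG : Monotone G) (hGfin : ∀ n, Finite (G n))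
    (hGex : ∀ z, ∃ n, z ∈ G n) (E : Z → X ≃ᵢ X)
    (hinj : ∀ g g', E g' x₀ ∈ comp X ε (E g x₀) → g = g')
    (hsurj : ∀ y, ∃ g, y ∈ comp X ε (E g x₀))
    (hsep : ∀ r : ℝ, ∃ k, ∀ g g', ∀ c ∈ comp X ε x₀, ∀ c' ∈ comp X ε x₀,
      dist (E g c) (E g' c') ≤ r → g - g' ∈ G k)
    (hbdd : ∀ k, ∃ M, ∀ g g', g - g' ∈ G k → ∀ c ∈ comp X ε x₀, dist (E g c) (E g' c) ≤ M) :
    CoarselyIsomorphic X (↥(comp X ε x₀) × Z) := by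
  have hsub : ∀ g g' : Z, dist g g' = dist (g - g') 0 := fun g g' => by
    have := hinv (-g') g g'
    rwa [neg_add_cancel, neg_add_eq_sub, eq_comm] at this
  let ψ : ↥(comp X ε x₀) × Z → X := fun p => E p.2 p.1
  have hψ : Function.Bijective ψ := by
    constructor
    · rintro ⟨⟨c, hc⟩, g⟩ ⟨⟨c', hc'⟩, g'⟩ h
      have h : E g c = E g' c' := h
      have hg : E g c ∈ comp X ε (E g x₀) := (map_mem_comp_iff (E g)).2 hc
      have hg' : E g' c' ∈ comp X ε (E g' x₀) := (map_mem_comp_iff (E g')).2 hc'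
      obtain rfl : g = g' := hinj g g' (mem_comp_trans hg (h ▸ mem_comp_comm.1 hg'))
      obtain rfl : c = c' := (E g).injective h
      rfl
    · intro y
      obtain ⟨g, hg⟩ := hsurj y
      refine ⟨⟨⟨(E g).symm y, ?_⟩, g⟩, (E g).apply_symm_apply y⟩
      rw [← map_mem_comp_iff (E g)]
      simpa using hg
  refine ⟨(Equiv.ofBijective ψ hψ).symm, ?_, ?_⟩
  · refine coarseMapM_of_dist_le fun r => ?_
    obtain ⟨k, hk⟩ := hsep r
    obtain ⟨M, hM⟩ := hbdd k
    obtain ⟨b, hb⟩ := (Set.toFinite ((fun z : Z => dist z 0) '' (G k : Set Z))).bddAbove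
    refine ⟨max (r + M) b, fun x x' hx => ?_⟩
    obtain ⟨⟨⟨c, hc⟩, g⟩, rfl⟩ := (Equiv.ofBijective ψ hψ).surjective x
    obtain ⟨⟨⟨c', hc'⟩, g'⟩, rfl⟩ := (Equiv.ofBijective ψ hψ).surjective x'
    rw [Equiv.symm_apply_apply, Equiv.symm_apply_apply]
    replace hx : dist (E g c) (E g' c') ≤ r := hx
    have hgg := hk g g' c hc c' hc' hx
    refine max_le_max ?_ ?_
    · calc dist c c' = dist (E g c) (E g c') := ((E g).dist_eq c c').symm
        _ ≤ dist (E g c) (E g' c') + dist (E g c') (E g' c') := dist_triangle_right _ _ _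
        _ ≤ r + M := add_le_add hx (hM g g' hgg c' hc')
    · exact (hsub g g').trans_le (hb ⟨_, hgg, rfl⟩)
  · refine coarseMapM_of_dist_le fun r => ?_
    obtain ⟨k, hk⟩ : ∃ k, Metric.closedBall (0 : Z) r ⊆ G k := by
      choose N hN using hGex
      obtain ⟨k, hk⟩ := ((hproper 0 r).image N).bddAbove
      exact ⟨k, fun z hz => hG (hk ⟨z, hz, rfl⟩) (hN z)⟩
    obtain ⟨M, hM⟩ := hbdd k
    refine ⟨r + M, ?_⟩
    rintro ⟨⟨c, hc⟩, g⟩ ⟨⟨c', hc'⟩, g'⟩ h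
    rw [Prod.dist_eq, max_le_iff] at h
    obtain ⟨h1, h2⟩ := h
    replace h1 : dist c c' ≤ r := h1
    have hgg : g - g' ∈ G k := hk ((hsub g g').symm.trans_le h2)
    calc dist (E g c) (E g' c') ≤ dist (E g c) (E g c') + dist (E g c') (E g' c') :=
          dist_triangle _ _ _
      _ ≤ r + M := add_le_add (((E g).dist_eq c c').trans_le h1) (hM g g' hgg c' hc')

theorem exists_copies_index (k : ℕ∞) :
    ∃ e : Copies k → ℕ, Function.Injective e ∧ ∀ i : ℕ, i ∈ Set.range e ↔ (i : ℕ∞) < k := by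
  unfold Copies
  by_cases hk : k = ⊤
  · rw [if_pos hk]
    exact ⟨id, Function.injective_id, fun i => by simp [hk]⟩
  · rw [if_neg hk]
    refine ⟨Fin.val, Fin.val_injective, fun i => ?_⟩
    lift k to ℕ using hk
    simp

theorem card_dfinsupp_supportedIn {ι : Type*} {A : ι → Type*} [∀ i, AddCommGroup (A i)]
    (I : Finset ι) {S : AddSubgroup (Π₀ i, A i)} (hS : ∀ f, f ∈ S ↔ ∀ i ∉ I, f i = 0) :
    Nat.card S = ∏ i ∈ I, Nat.card (A i) := by
  classical
  rw [← Finset.prod_coe_sort, ← Nat.card_pi]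
  refine Nat.card_congr (Equiv.ofBijective (fun f (i : I) => (f : Π₀ i, A i) i) ⟨?_, ?_⟩)
  · rintro ⟨f, hf⟩ ⟨f', hf'⟩ h
    refine Subtype.ext (DFinsupp.ext fun i => ?_)
    by_cases hi : i ∈ I
    · exact congrFun h ⟨i, hi⟩
    · exact ((hS f).1 hf i hi).trans ((hS f').1 hf' i hi).symm
  · intro h
    refine ⟨⟨DFinsupp.mk I h, (hS _).2 fun i hi => DFinsupp.mk_of_notMem hi⟩, ?_⟩
    funext i
    exact DFinsupp.mk_of_mem i.2

/-- `ℤ_φ` is exhausted by a tower of subgroups of orders `N 0 ∣ N 1 ∣ …` as soon as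
`φ p` is the supremum of the `p`-adic valuations of the `N n`. -/
theorem exists_tower_zphi (φ : Nat.Primes → ℕ∞) {N : ℕ → ℕ} (hN0 : ∀ n, N n ≠ 0)
    (hdvd : ∀ n, N n ∣ N (n + 1))
    (hlt : ∀ (p : Nat.Primes) (i : ℕ), (i : ℕ∞) < φ p ↔ ∃ n, i < (N n).factorization p) :
    ∃ G : ℕ → AddSubgroup (Zphi φ), Monotone G ∧ (∀ n, Nat.card (G n) = N n) ∧
      ∀ z, ∃ n, z ∈ G n := by
  classical
  choose e he hrange using fun p : Nat.Primes => exists_copies_index (φ p)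
  let coeff : Zphi φ →+ ∀ x : Σ p : Nat.Primes, Copies (φ p), ZMod (x.1 : ℕ) :=
    DFinsupp.coeFnAddMonoidHom
  let G : ℕ → AddSubgroup (Zphi φ) := fun n =>
    { carrier := {f | ∀ x, ¬ e x.1 x.2 < (N n).factorization x.1 → coeff f x = 0}
      zero_mem' := fun x _ => by rw [map_zero]; rfl
      add_mem' := fun {f g} hf hg x hx => by
        rw [map_add, Pi.add_apply, hf x hx, hg x hx, add_zero]
      neg_mem' := fun {f} hf x hx => by rw [map_neg, Pi.neg_apply, hf x hx, neg_zero] }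
  have hmono : ∀ m n, m ≤ n → (N m).factorization ≤ (N n).factorization := fun m n hmn =>
    (Nat.factorization_le_iff_dvd (hN0 m) (hN0 n)).2
      (Nat.le_induction (dvd_refl _) (fun k _ ih => ih.trans (hdvd k)) n hmn)
  refine ⟨G, ?_, ?_, ?_⟩
  · exact fun m n hmn f hf x hx => hf x fun h => hx (h.trans_le (hmono m n hmn _))
  · intro n
    let j : (Σ p : Nat.Primes, Copies (φ p)) → Σ _ : ℕ, ℕ := fun x => ⟨x.1, e x.1 x.2⟩
    have hj : Function.Injective j := by
      rintro ⟨p, c⟩ ⟨p', c'⟩ h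
      simp only [j, Sigma.mk.injEq, heq_eq_eq] at h
      obtain rfl : p = p' := Subtype.ext h.1
      rw [he p h.2]
    let S : Finset (Σ _ : ℕ, ℕ) :=
      (N n).primeFactors.sigma fun p => Finset.range ((N n).factorization p)
    have hjS : ∀ x, j x ∈ S ↔ e x.1 x.2 < (N n).factorization x.1 := by
      intro x
      simp only [S, j, Finset.mem_sigma, Finset.mem_range, and_iff_right_iff_imp]
      intro h
      rw [← Nat.support_factorization, Finsupp.mem_support_iff]
      omega
    let I := S.preimage j hj.injOn
    refine (card_dfinsupp_supportedIn I (S := G n) fun f => ?_).trans ?_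
    · simp only [I, Finset.mem_preimage, hjS]
      rfl
    · simp only [Nat.card_zmod]
      rw [Finset.prod_preimage j S hj.injOn (fun y => y.1), Finset.prod_sigma]
      · conv_rhs => rw [← Nat.prod_factorization_pow_eq_self (hN0 n)]
        simp [Finsupp.prod]
      · rintro ⟨p, i⟩ hpi hni
        exfalso
        simp only [S, Finset.mem_sigma, Finset.mem_range] at hpi
        have hp := Nat.prime_of_mem_primeFactors hpi.1
        obtain ⟨c, hc⟩ := (hrange ⟨p, hp⟩ i).2 ((hlt ⟨p, hp⟩ i).2 ⟨n, hpi.2⟩)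
        exact hni ⟨⟨⟨p, hp⟩, c⟩, by simp [j, hc]⟩
  · intro z
    choose n hn using fun x : Σ p : Nat.Primes, Copies (φ p) =>
      (hlt x.1 (e x.1 x.2)).1 ((hrange x.1 _).1 ⟨x.2, rfl⟩)
    have hsupp : {x | coeff z x ≠ 0}.Finite := DFinsupp.finite_support z
    obtain ⟨b, hb⟩ := (hsupp.image n).bddAbove
    refine ⟨b, fun x hx => ?_⟩
    by_contra hne
    exact hx ((hn x).trans_le (hmono _ _ (hb ⟨x, hne, rfl⟩) _))

theorem lt_natSup_iff {s : Set ℕ} {i : ℕ} : (i : ℕ∞) < natSup s ↔ ∃ k ∈ s, i < k := by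
  simp [natSup, lt_sSup_iff]

theorem lt_phiSpace_iff {X : Type*} [MetricSpace X] (hX : Homogeneous X) (x₀ : X)
    (hfin : ∀ δ : ℝ≥0∞, δ ≠ ⊤ → (comp X (sStep X) '' comp X δ x₀).Finite)
    {t : ℕ → ℝ≥0∞} (ht : ∀ n, t n ≠ ⊤)
    (htex : ∀ δ : ℝ≥0∞, δ ≠ ⊤ → ∃ n, δ ≤ t n) (p : Nat.Primes) (i : ℕ) :
    (i : ℕ∞) < phiSpace X p ↔
      ∃ n, i < ((comp X (sStep X) '' comp X (t n) x₀).ncard).factorization p := by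
  have hne : ∀ n, (comp X (sStep X) '' comp X (t n) x₀).ncard ≠ 0 := fun n =>
    Set.ncard_ne_zero_of_mem ⟨x₀, mem_comp_self _ _, rfl⟩ (hfin _ (ht n))
  rw [phiSpace, lt_natSup_iff]
  constructor
  · rintro ⟨k, ⟨δ, hδ, x, -, hk⟩, hik⟩
    obtain ⟨n, hn⟩ := htex δ hδ
    refine ⟨n, hik.trans_le ((p.2.pow_dvd_iff_le_factorization (hne n)).1 (hk.trans ?_))⟩
    rw [ncard_comp_image_comp hX _ _ x x₀]
    rcases le_total (sStep X) δ with h | h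
    · exact Dvd.intro_left _ (ncard_comp_image_comp_mul hX h hn x₀ (hfin _ (ht n)))
    · rw [comp_image_comp_of_le h, Set.ncard_singleton]
      exact one_dvd _
  · rintro ⟨n, hn⟩
    exact ⟨_, ⟨t n, ht n, x₀, hfin _ (ht n), Nat.ordProj_dvd _ _⟩, hn⟩

theorem subsingleton_zphi_phiSpace {X : Type*} [MetricSpace X] (hs : sStep X = ⊤) :
    Subsingleton (Zphi (phiSpace X)) := by
  have hempty : IsEmpty (Σ p : Nat.Primes, Copies (phiSpace X p)) := by
    refine ⟨fun ⟨p, c⟩ => ?_⟩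
    obtain ⟨e, -, hrange⟩ := exists_copies_index (phiSpace X p)
    have h := (hrange (e c)).1 ⟨c, rfl⟩
    rw [phiSpace, lt_natSup_iff] at h
    obtain ⟨k, ⟨δ, hδ, x, -, hk⟩, hek⟩ := h
    rw [comp_image_comp_of_le (hs ▸ le_top), Set.ncard_singleton, Nat.dvd_one] at hk
    have := p.2.one_lt
    rcases Nat.pow_eq_one.1 hk with h | h <;> omega
  exact inferInstanceAs
    (Subsingleton (Π₀ x : Σ p : Nat.Primes, Copies (phiSpace X p), ZMod (x.1 : ℕ)))

/-- Theorem 1.4: each boundedly-finite shift-homogeneous metric space `X` is coarsely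
isomorphic to the product `X_{s(X)} × ℤ_{φ_X}`, where `ℤ_{φ_X}` carries any proper
left-invariant metric. -/
theorem shift_homogeneous_space_factors_as_product
    (X : Type*) [MetricSpace X] (hXb : BoundedlyFinite X) (hX : ShiftHomogeneous X) (x₀ : X)
    [MetricSpace (Zphi (phiSpace X))]
    (hinv : ∀ a x y : Zphi (phiSpace X), dist (a + x) (a + y) = dist x y)
    (hproper : ProperMetric (Zphi (phiSpace X))) :
    CoarselyIsomorphic X (↥(comp X (sStep X) x₀) × Zphi (phiSpace X)) := by
  by_cases hs : sStep X = ⊤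
  · have := subsingleton_zphi_phiSpace hs
    have htop : ∀ x y : X, y ∈ comp X (sStep X) x := fun x y =>
      mem_comp_of_edist_le (hs ▸ le_top)
    exact coarselyIsomorphic_prod_of_isometries hinv hproper (G := fun _ => ⊤) monotone_const
      (fun _ => inferInstance) (fun _ => ⟨0, AddSubgroup.mem_top _⟩)
      (fun _ => IsometryEquiv.refl X) (fun _ _ _ => Subsingleton.elim _ _)
      (fun y => ⟨0, htop _ y⟩) (fun _ => ⟨0, fun _ _ _ _ _ _ _ => AddSubgroup.mem_top _⟩)
      (fun _ => ⟨0, fun _ _ _ c _ => (dist_self c).le⟩)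
  have hXh := hX.homogeneous
  have hfin : ∀ δ : ℝ≥0∞, δ ≠ ⊤ → (comp X (sStep X) '' comp X δ x₀).Finite := fun δ hδ =>
    finite_comp_sStep_image_comp hXb hXh hs hδ x₀
  let t : ℕ → ℝ≥0∞ := fun n => sStep X + n
  have ht0 : t 0 = sStep X := by simp [t]
  have htmono : Monotone t := fun m n hmn => by
    simp only [t]
    gcongr
  have hst : ∀ n, sStep X ≤ t n := fun n => le_self_add
  have httop : ∀ n, t n ≠ ⊤ := fun n => by simp [t, hs]
  have htex : ∀ δ : ℝ≥0∞, δ ≠ ⊤ → ∃ n, δ ≤ t n := fun δ hδ => by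
    obtain ⟨n, hn⟩ := ENNReal.exists_nat_gt hδ
    exact ⟨n, hn.le.trans le_add_self⟩
  let N : ℕ → ℕ := fun n => (comp X (sStep X) '' comp X (t n) x₀).ncard
  have hN0 : ∀ n, N n ≠ 0 := fun n =>
    Set.ncard_ne_zero_of_mem ⟨x₀, mem_comp_self _ _, rfl⟩ (hfin _ (httop n))
  have hmul : ∀ n, (comp X (t n) '' comp X (t (n + 1)) x₀).ncard * N n = N (n + 1) := fun n =>
    ncard_comp_image_comp_mul hXh (hst n) (htmono n.le_succ) x₀ (hfin _ (httop _))
  obtain ⟨G, hG, hGcard, hGex⟩ := exists_tower_zphi (phiSpace X) hN0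
    (fun n => Dvd.intro_left _ (hmul n)) (lt_phiSpace_iff hXh x₀ hfin httop htex)
  have hGfin : ∀ n, Finite (G n) := fun n =>
    Nat.finite_of_card_ne_zero (by rw [hGcard]; exact hN0 n)
  have hG0 : G 0 = ⊥ := by
    rw [← AddSubgroup.card_eq_one, hGcard]
    simp only [N, ht0, comp_image_comp_of_le le_rfl, Set.ncard_singleton]
  obtain ⟨E, hE, hEsurj, hEbdd⟩ := exists_isometries_of_tower hX x₀ hG hGfin hGex htmono
    (httop 0) (fun n => finite_comp_image_comp_of_le (hst n) (hfin _ (httop _)))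
    (fun n => by rw [hGcard, hGcard, hmul])
  rw [ht0] at hEsurj hEbdd
  refine coarselyIsomorphic_prod_of_isometries hinv hproper hG hGfin hGex E ?_ ?_ ?_ hEbdd
  · intro g g' h
    rw [← ht0, ← hE, hG0, AddSubgroup.mem_bot, sub_eq_zero] at h
    exact h
  · intro y
    obtain ⟨n, hn⟩ := htex (edist x₀ y) (edist_ne_top _ _)
    exact hEsurj n y (mem_comp_of_edist_le hn)
  · intro r
    obtain ⟨k, hk⟩ := htex (ENNReal.ofReal r) ENNReal.ofReal_ne_top
    refine ⟨k, fun g g' c hc c' hc' h => (hE k g g').2 ?_⟩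
    have hle : edist (E g c) (E g' c') ≤ t k := by
      rw [edist_dist]
      exact (ENNReal.ofReal_le_ofReal h).trans hk
    exact mem_comp_trans (mem_comp_trans
      ((map_mem_comp_iff (E g)).2 (comp_mono (hst k) _ hc)) (mem_comp_of_edist_le hle))
      (mem_comp_comm.1 ((map_mem_comp_iff (E g')).2 (comp_mono (hst k) _ hc')))

end
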